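/- Let S be a nonempty closed subset of 𝕋^d, and for n ≥ 2 set S^n := S + S^{n−1} (so S^n is the set of sums of n elements of S). Then the following are equivalent: (i) for every k ∈ ℤ^d \ {0} there exists α ∈ S with ⟨k, α⟩ ∉ ℤ; (ii) the closure of ⋃_{n ≥ 1} S^n equals 𝕋^d. -/

import Mathlib

open MeasureTheory Filter Topology Pointwise

noncomputable section

/-- The `d`-dimensional torus `𝕋^d = (ℝ/ℤ)^d`. -/
abbrev Td (d : ℕ) : Type := Fin d → AddCircle (1 : ℝ)

/-- `⟨k, α⟩ = k₁α₁ + ⋯ + k_dα_d ∈ AddCircle 1`; it "is an integer" iff it is `0`. -/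
def pairing {d : ℕ} (k : Fin d → ℤ) (α : Td d) : AddCircle (1:ℝ) :=
  ∑ j, k j • α j

/-- `iterSum S n = S^{n+1}`, the Minkowski sum of `n+1` copies of `S`
(so `S^1 = S` and `S^{n+1} = S + S^n`). -/
def iterSum {d : ℕ} (S : Set (Td d)) : ℕ → Set (Td d)
  | 0 => S
  | n + 1 => S + iterSum S n

theorem mFourier_eq_toCircle_pairing {d : ℕ} (k : Fin d → ℤ) (x : Td d) :
    UnitAddTorus.mFourier k x = (AddCircle.toCircle (pairing k x) : ℂ) := by
  have h := map_prod (AddCircle.toCircle_addChar (T := 1)).toMonoidHom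
    (fun j => Multiplicative.ofAdd (k j • x j)) Finset.univ
  rw [← ofAdd_sum] at h
  change AddCircle.toCircle (pairing k x) = ∏ j, AddCircle.toCircle (k j • x j) at h
  rw [h]
  exact (map_prod Circle.coeHom (fun j => AddCircle.toCircle (k j • x j)) Finset.univ).symm

theorem pairing_add {d : ℕ} (k : Fin d → ℤ) (x y : Td d) :
    pairing k (x + y) = pairing k x + pairing k y := by
  simp [pairing, Finset.sum_add_distrib]

theorem continuous_pairing {d : ℕ} (k : Fin d → ℤ) : Continuous (pairing k) := by
  unfold pairing
  fun_prop

theorem exists_pairing_ne_zero {d : ℕ} {k : Fin d → ℤ} (hk : k ≠ 0) :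
    ∃ x : Td d, pairing k x ≠ 0 := by
  obtain ⟨j, hj⟩ := Function.ne_iff.mp hk
  refine ⟨Pi.single j ((1 / (2 * k j) : ℝ) : AddCircle (1 : ℝ)), ?_⟩
  have hsum : pairing k (Pi.single j ((1 / (2 * k j) : ℝ) : AddCircle (1 : ℝ)))
      = ((1 / 2 : ℝ) : AddCircle (1 : ℝ)) := by
    rw [pairing, Finset.sum_eq_single j (fun i _ hi => by simp [hi]) (by simp),
      Pi.single_eq_same, ← AddCircle.coe_zsmul]
    have : (k j : ℝ) ≠ 0 := by exact_mod_cast hj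
    congr 1
    rw [zsmul_eq_mul]
    field_simp
  rw [hsum, Ne, AddCircle.coe_eq_zero_iff]
  rintro ⟨n, hn⟩
  rw [zsmul_eq_mul, mul_one] at hn
  have h2 : ((2 * n : ℤ) : ℝ) = (1 : ℤ) := by push_cast; linarith
  have := Int.cast_injective h2
  omega

theorem pairing_eq_zero_of_mem_iterSum {d : ℕ} {S : Set (Td d)} {k : Fin d → ℤ}
    (h : ∀ α ∈ S, pairing k α = 0) (n : ℕ) : ∀ α ∈ iterSum S n, pairing k α = 0 := by
  induction n with
  | zero => exact h
  | succ n ih =>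
    rintro _ ⟨a, ha, b, hb, rfl⟩
    rw [pairing_add, h a ha, ih b hb, add_zero]

theorem addSubmonoid_closure_subset_insert_iUnion_iterSum {d : ℕ} (S : Set (Td d)) :
    (AddSubmonoid.closure S : Set (Td d)) ⊆ insert 0 (⋃ n, iterSum S n) := by
  intro x hx
  induction hx using AddSubmonoid.closure_induction_left with
  | zero => exact Set.mem_insert _ _
  | add_left a ha y _ ih =>
    right
    rcases ih with rfl | ih
    · exact Set.mem_iUnion.mpr ⟨0, by simpa [iterSum] using ha⟩
    · obtain ⟨n, hn⟩ := Set.mem_iUnion.mp ih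
      exact Set.mem_iUnion.mpr ⟨n + 1, Set.add_mem_add ha hn⟩

theorem nsmul_succ_mem_iterSum {d : ℕ} {S : Set (Td d)} {a : Td d} (ha : a ∈ S) (n : ℕ) :
    (n + 1) • a ∈ iterSum S n := by
  induction n with
  | zero => simpa [iterSum] using ha
  | succ n ih =>
    rw [succ_nsmul']
    exact Set.add_mem_add ha ih

theorem zero_mem_closure_iUnion_iterSum {d : ℕ} {S : Set (Td d)} (hS : S.Nonempty) :
    (0 : Td d) ∈ closure (⋃ n, iterSum S n) := by
  obtain ⟨a, ha⟩ := hS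
  refine mem_closure_iff_clusterPt.mpr ((mapClusterPt_zero_atTop_nsmul a).clusterPt.mono ?_)
  rw [le_principal_iff, mem_map]
  filter_upwards [eventually_ge_atTop 1] with n hn
  obtain ⟨m, rfl⟩ := Nat.exists_eq_add_of_le' hn
  exact Set.mem_iUnion.mpr ⟨m, nsmul_succ_mem_iterSum ha m⟩

theorem addSubgroup_closure_subset_closure_iUnion_iterSum {d : ℕ} {S : Set (Td d)}
    (hS : S.Nonempty) :
    closure (AddSubgroup.closure S : Set (Td d)) ⊆ closure (⋃ n, iterSum S n) := by
  rw [← closure_addSubmonoidClosure_eq_closure_addSubgroupClosure]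
  refine closure_minimal ((addSubmonoid_closure_subset_insert_iUnion_iterSum S).trans ?_)
    isClosed_closure
  exact Set.insert_subset (zero_mem_closure_iUnion_iterSum hS) subset_closure

/-- A nontrivial character has integral zero against a measure that is invariant under a
translation on which the character is nontrivial. -/
theorem integral_mFourier_eq_zero {d : ℕ} (μ : Measure (Td d)) {k : Fin d → ℤ} {a : Td d}
    (hμ : MeasurePreserving (a + ·) μ μ) (ha : pairing k a ≠ 0) :
    ∫ x, UnitAddTorus.mFourier k x ∂μ = 0 := by
  have h := hμ.integral_comp (Homeomorph.addLeft a).measurableEmbedding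
    (fun x => UnitAddTorus.mFourier k x)
  simp_rw [mFourier_eq_toCircle_pairing, pairing_add, AddCircle.toCircle_add, Circle.coe_mul,
    integral_const_mul] at h ⊢
  have hne : (AddCircle.toCircle (pairing k a) : ℂ) ≠ 1 := by
    intro h1
    refine ha (AddCircle.injective_toCircle one_ne_zero (Circle.ext ?_))
    simpa using h1
  exact (mul_left_eq_self₀.mp h).resolve_left hne

theorem measure_ext_of_integral_mFourier {d : ℕ} {μ ν : Measure (Td d)}
    [IsFiniteMeasure μ] [IsFiniteMeasure ν]
    (h : ∀ k : Fin d → ℤ,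
      ∫ x, UnitAddTorus.mFourier k x ∂μ = ∫ x, UnitAddTorus.mFourier k x ∂ν) : μ = ν := by
  have hfint (ρ : Measure (Td d)) [IsFiniteMeasure ρ] (f : C(Td d, ℂ)) : Integrable f ρ :=
    f.continuous.integrable_of_hasCompactSupport (HasCompactSupport.of_compactSpace f)
  have hspan : ∀ f ∈ Submodule.span ℂ (Set.range (UnitAddTorus.mFourier (d := Fin d))),
      ∫ x, f x ∂μ = ∫ x, f x ∂ν := by
    intro f hf
    induction hf using Submodule.span_induction with
    | mem f hf =>
      obtain ⟨k, rfl⟩ := hf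
      exact h k
    | zero => simp
    | add f g _ _ hf hg =>
      simp_rw [ContinuousMap.add_apply]
      rw [integral_add (hfint μ f) (hfint μ g), integral_add (hfint ν f) (hfint ν g), hf, hg]
    | smul c f _ hf =>
      simp_rw [ContinuousMap.smul_apply]
      rw [integral_smul, integral_smul, hf]
  refine ext_of_forall_mem_subalgebra_integral_eq_of_pseudoEMetric_complete_countable (𝕜 := ℂ)
    (A := (UnitAddTorus.mFourierSubalgebra (Fin d)).comap
      (BoundedContinuousFunction.toContinuousMapStarₐ ℂ)) ?_ fun g hg => ?_
  · intro x y hxy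
    obtain ⟨_, ⟨f, hf, rfl⟩, hne⟩ := UnitAddTorus.mFourierSubalgebra_separatesPoints hxy
    exact ⟨f, ⟨f, ⟨BoundedContinuousFunction.mkOfCompact f, hf, rfl⟩, rfl⟩, hne⟩
  · refine hspan (g : C(Td d, ℂ)) ?_
    rw [← UnitAddTorus.mFourierSubalgebra_coe]
    exact hg

/-- A closed subgroup of the torus on which no nontrivial character is trivial is the whole torus:
its Haar measure has the same Fourier coefficients as that of the torus. -/
theorem eq_univ_of_isClosed_addSubgroup {d : ℕ} (H : AddSubgroup (Td d))
    (hH : IsClosed (H : Set (Td d)))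
    (h : ∀ k : Fin d → ℤ, k ≠ 0 → ∃ α ∈ H, pairing k α ≠ 0) : (H : Set (Td d)) = Set.univ := by
  have : CompactSpace H := isCompact_iff_compactSpace.mp hH.isCompact
  let μH : Measure H := Measure.addHaarMeasure ⊤
  let μ : Measure (Td d) := μH.map Subtype.val
  let ν : Measure (Td d) := Measure.addHaarMeasure ⊤
  have : IsProbabilityMeasure μH := ⟨Measure.addHaarMeasure_self⟩
  have : IsProbabilityMeasure ν := ⟨Measure.addHaarMeasure_self⟩
  have : IsProbabilityMeasure μ :=
    Measure.isProbabilityMeasure_map measurable_subtype_coe.aemeasurable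
  have hμ (a : Td d) (ha : a ∈ H) : MeasurePreserving (a + ·) μ μ := by
    refine ⟨measurable_const_add a, ?_⟩
    have hcomp : (a + ·) ∘ (Subtype.val : H → Td d) = Subtype.val ∘ ((⟨a, ha⟩ : H) + ·) := rfl
    rw [Measure.map_map (measurable_const_add a) measurable_subtype_coe, hcomp,
      ← Measure.map_map measurable_subtype_coe (measurable_const_add _), map_add_left_eq_self]
  have hμν : μ = ν := by
    refine measure_ext_of_integral_mFourier fun k => ?_
    by_cases hk : k = 0
    · simp [hk, UnitAddTorus.mFourier_zero]
    · obtain ⟨a, haH, ha⟩ := h k hk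
      rw [integral_mFourier_eq_zero μ (hμ a haH) ha,
        integral_mFourier_eq_zero ν (measurePreserving_add_left ν a) ha]
  have hcompl : ν (H : Set (Td d))ᶜ = 0 := by
    rw [← hμν, Measure.map_apply measurable_subtype_coe hH.measurableSet.compl]
    convert measure_empty (μ := μH)
    ext x
    simp
  exact Set.compl_empty_iff.mp (hH.isOpen_compl.measure_eq_zero_iff ν |>.mp hcompl)

/-- For a nonempty closed `S ⊆ 𝕋^d`, the following are
equivalent: (i) for every `k ∈ ℤ^d \ {0}` there is `α ∈ S` with `⟨k, α⟩ ∉ ℤ`;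
(ii) the closure of `⋃_{n ≥ 1} S^n` is all of `𝕋^d`. -/
theorem pairing_nonint_iff_closure_iterSum_eq_univ {d : ℕ}
    (S : Set (Td d)) (hSne : S.Nonempty) (hScl : IsClosed S) :
    (∀ k : Fin d → ℤ, k ≠ 0 → ∃ α ∈ S, pairing k α ≠ 0) ↔
      closure (⋃ n : ℕ, iterSum S n) = Set.univ := by
  constructor
  · intro h
    refine Set.eq_univ_of_univ_subset ?_
    rw [← eq_univ_of_isClosed_addSubgroup (AddSubgroup.closure S).topologicalClosure
      (AddSubgroup.isClosed_topologicalClosure _) fun k hk => ?_]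
    · exact addSubgroup_closure_subset_closure_iUnion_iterSum hSne
    · obtain ⟨α, hα, hne⟩ := h k hk
      exact ⟨α, subset_closure (AddSubgroup.subset_closure hα), hne⟩
  · intro h k hk
    by_contra! hS
    obtain ⟨x, hx⟩ := exists_pairing_ne_zero hk
    refine hx (closure_minimal (t := {y | pairing k y = 0}) ?_
      (isClosed_eq (continuous_pairing k) continuous_const) (h ▸ Set.mem_univ x))
    exact Set.iUnion_subset fun n => pairing_eq_zero_of_mem_iterSum hS n
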